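/- arXiv:1003.1699 — 3 statements merged into one kernel-verified Lean document; each statement's English description precedes it below -/
import Mathlib

section
/- Let N ≥ 1, s ∈ (0,2), Λ > 1. Define ψ(x) = (|x|^{s/2} − 1)_+ and for L ≥ 0 set ψ_L = L + ψ. There exists a constant C, depending only on N, s, and Λ, such that for any kernel K satisfying condition (D), any t, any L ≥ 0, and any measurable w: ℝ^N → ℝ with (w − ψ_L)_+ ∈ L¹(ℝ^N): |∫∫_{{|x−y| ≥ 1}} K(t,x,y) (ψ(x) − ψ(y)) ((w − ψ_L)_+(x) − (w − ψ_L)_+(y)) dx dy| ≤ C ∫_{ℝ^N} (w − ψ_L)_+(x) dx. -/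
open MeasureTheory Set Metric Filter
open scoped ENNReal NNReal Topology RealInnerProductSpace

noncomputable section

/-- Euclidean space `ℝ^N`. -/
abbrev En (N : ℕ) := EuclideanSpace ℝ (Fin N)

/-- Condition (D) on a time-dependent kernel `K`: symmetry in `x, y` and the
two-sided bound `1_{|x-y|≤3} (1-s/2) Λ⁻¹ |x-y|^{-(N+s)} ≤ K(t,x,y) ≤ (1-s/2) Λ |x-y|^{-(N+s)}`. -/
def CondD (N : ℕ) (s Λ : ℝ) (K : ℝ → En N → En N → ℝ) : Prop :=
  ∀ (t : ℝ) (x y : En N), x ≠ y →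
    K t x y = K t y x ∧
    (if ‖x - y‖ ≤ 3 then (1 - s / 2) * Λ⁻¹ * ‖x - y‖ ^ (-((N : ℝ) + s)) else 0) ≤ K t x y ∧
    K t x y ≤ (1 - s / 2) * Λ * ‖x - y‖ ^ (-((N : ℝ) + s))

/-- Square of the Gagliardo `H^{s/2}(ℝ^N)` seminorm. -/
def gagliardoSq (N : ℕ) (s : ℝ) (v : En N → ℝ) : ℝ≥0∞ :=
  ∫⁻ x, ∫⁻ y, ENNReal.ofReal ((v x - v y) ^ 2 * ‖x - y‖ ^ (-((N : ℝ) + s)))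

/-- The bilinear form `B_K[u,v] = ∫∫ K(t,x,y)(u(x)-u(y))(v(x)-v(y)) dx dy` at a fixed time. -/
def Bform (N : ℕ) (Kt : En N → En N → ℝ) (u v : En N → ℝ) : ℝ :=
  ∫ x, ∫ y, Kt x y * (u x - u y) * (v x - v y)

/-- Weak solution of `∂ₜ w(t,x) = ∫ (w(t,y) - w(t,x)) K(t,x,y) dy` on the time set `I`:
`w ∈ L^∞(I; L²)`, `∫_I ‖w(t)‖²_{H^{s/2}} dt < ∞`, and for every test function `η` the identity
`d/dt ∫ w η dx + B_K[w(t,·), η] = 0` holds in the distributional sense on `I`. -/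
def IsWeakSolution (N : ℕ) (s : ℝ) (K : ℝ → En N → En N → ℝ) (I : Set ℝ)
    (w : ℝ → En N → ℝ) : Prop :=
  Measurable (Function.uncurry w) ∧
  (∃ C : ℝ, ∀ t ∈ I, ∫⁻ x, ENNReal.ofReal ((w t x) ^ 2) ≤ ENNReal.ofReal C) ∧
  (∫⁻ t in I, gagliardoSq N s (w t)) < ⊤ ∧
  ∀ η : En N → ℝ, ContDiff ℝ (⊤ : ℕ∞) η → HasCompactSupport η →
    ∀ χ : ℝ → ℝ, ContDiff ℝ (⊤ : ℕ∞) χ → HasCompactSupport χ → tsupport χ ⊆ interior I →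
      ∫ t in I, (-(deriv χ t) * ∫ x, w t x * η x + χ t * Bform N (K t) (w t) η) = 0

/-- The barrier `ψ(x) = (|x|^{s/2} - 1)₊`. -/
def psiFn (N : ℕ) (s : ℝ) (x : En N) : ℝ := max (‖x‖ ^ (s / 2) - 1) 0

/-- The barrier `ψ₁(x) = (|x|^{s/4} - 1)₊`. -/
def psi1Fn (N : ℕ) (s : ℝ) (x : En N) : ℝ := max (‖x‖ ^ (s / 4) - 1) 0

/-- The barrier `ψ_λ`: vanishing for `|x| ≤ λ^{-4/s}` and `((|x| - λ^{-4/s})^{s/4} - 1)₊` beyond. -/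
def psiLam (N : ℕ) (s lam : ℝ) (x : En N) : ℝ :=
  if ‖x‖ ≤ lam ^ (-(4 / s)) then 0 else max ((‖x‖ - lam ^ (-(4 / s))) ^ (s / 4) - 1) 0

/-- The barrier `ψ_{ε,λ}`: vanishing for `|x| ≤ λ^{-4/s}` and `((|x| - λ^{-4/s})^ε - 1)₊` beyond. -/
def psiEpsLam (N : ℕ) (s eps lam : ℝ) (x : En N) : ℝ :=
  if ‖x‖ ≤ lam ^ (-(4 / s)) then 0 else max ((‖x‖ - lam ^ (-(4 / s))) ^ eps - 1) 0

/-- The cut-off profile `F(x) = max(-1, min(0, |x|² - 9))`. -/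
def Ffn (N : ℕ) (x : En N) : ℝ := max (-1) (min 0 (‖x‖ ^ 2 - 9))

/-- For `0 ≤ a ≤ 1`, the map `r ↦ r ^ a` is `a`-Hölder on `[0, ∞)` with constant one. -/
lemma abs_rpow_sub_rpow_le {a p q r : ℝ} (ha : 0 ≤ a) (ha1 : a ≤ 1) (hp : 0 ≤ p) (hq : 0 ≤ q)
    (hr : |p - q| ≤ r) : |p ^ a - q ^ a| ≤ r ^ a := by
  have key : ∀ {u v : ℝ}, 0 ≤ u → 0 ≤ v → |u - v| ≤ r → u ^ a - v ^ a ≤ r ^ a := by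
    intro u v hu hv h
    have hr0 : 0 ≤ r := (abs_nonneg _).trans h
    have h1 : u ^ a ≤ (v + r) ^ a :=
      Real.rpow_le_rpow hu (by linarith [le_abs_self (u - v)]) ha
    linarith [Real.rpow_add_le_add_rpow hv hr0 ha ha1]
  exact abs_sub_le_iff.2 ⟨key hp hq hr, key hq hp (by rwa [abs_sub_comm])⟩

lemma abs_psiFn_sub_le {N : ℕ} {s : ℝ} (hs0 : 0 ≤ s) (hs2 : s ≤ 2) (x y : En N) :
    |psiFn N s x - psiFn N s y| ≤ ‖x - y‖ ^ (s / 2) := by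
  refine (abs_max_sub_max_le_abs _ _ _).trans ?_
  rw [sub_sub_sub_cancel_right]
  exact abs_rpow_sub_rpow_le (by linarith) (by linarith) (norm_nonneg _) (norm_nonneg _)
    (abs_norm_sub_norm_le x y)

lemma CondD.abs_le {N : ℕ} {s Λ : ℝ} {K : ℝ → En N → En N → ℝ} (hK : CondD N s Λ K)
    (hs : s ≤ 2) (hΛ : 0 ≤ Λ) (t : ℝ) {x y : En N} (hxy : x ≠ y) :
    |K t x y| ≤ (1 - s / 2) * Λ * ‖x - y‖ ^ (-((N : ℝ) + s)) := by
  obtain ⟨-, hlo, hhi⟩ := hK t x y hxy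
  refine _root_.abs_le.2 ⟨?_, hhi⟩
  have hs' : 0 ≤ 1 - s / 2 := by linarith
  have h0 : 0 ≤ K t x y := le_trans (by split_ifs <;> positivity) hlo
  have : 0 ≤ (1 - s / 2) * Λ * ‖x - y‖ ^ (-((N : ℝ) + s)) := by positivity
  linarith

lemma rpow_neg_le_of_one_le {r a : ℝ} (hr : 1 ≤ r) (ha : 0 ≤ a) :
    r ^ (-a) ≤ 2 ^ a * (1 + r) ^ (-a) := by
  have h : (1 + r) ^ a ≤ 2 ^ a * r ^ a := by
    rw [← Real.mul_rpow (by norm_num) (by linarith)]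
    exact Real.rpow_le_rpow (by linarith) (by linarith) ha
  have h1 : 0 < r ^ a := Real.rpow_pos_of_pos (by linarith) a
  have h2 : 0 < (1 + r) ^ a := Real.rpow_pos_of_pos (by linarith) a
  rw [Real.rpow_neg (by linarith), Real.rpow_neg (by linarith), ← div_eq_mul_inv, inv_eq_one_div,
    div_le_div_iff₀ h1 h2]
  linarith

section ConvolutionIntegrand

variable {G : Type*} [AddGroup G] [MeasurableSpace G] [MeasurableAdd₂ G] [MeasurableNeg G]
  {μ : Measure G} [SFinite μ] [μ.IsAddRightInvariant] {g f : G → ℝ}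

lemma integrable_comp_sub_mul (hg : Integrable g μ) (hf : Integrable f μ) :
    Integrable (fun p : G × G => g (p.1 - p.2) * f p.2) (μ.prod μ) :=
  (measurePreserving_sub_prod μ μ).integrable_comp_of_integrable (hg.mul_prod hf)

lemma integral_comp_sub_mul (hg : Integrable g μ) (hf : Integrable f μ) :
    ∫ p : G × G, g (p.1 - p.2) * f p.2 ∂μ.prod μ = (∫ x, g x ∂μ) * ∫ x, f x ∂μ := by
  have h := measurePreserving_sub_prod μ μ
  rw [← integral_prod_mul, ← integral_map (φ := fun z : G × G => (z.1 - z.2, z.2))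
    (f := fun q : G × G => g q.1 * f q.2) h.measurable.aemeasurable, h.map_eq]
  rw [h.map_eq]
  exact (hg.mul_prod hf).aestronglyMeasurable

/-- Young's inequality on the product, symmetrized. -/
lemma integral_comp_sub_mul_add (hg : Integrable g μ) (hf : Integrable f μ)
    (heven : ∀ x, g (-x) = g x) :
    Integrable (fun p : G × G => g (p.1 - p.2) * (f p.1 + f p.2)) (μ.prod μ) ∧
      ∫ p : G × G, g (p.1 - p.2) * (f p.1 + f p.2) ∂μ.prod μ =
        2 * (∫ x, g x ∂μ) * ∫ x, f x ∂μ := by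
  have h1 := integrable_comp_sub_mul hg hf
  have h2 : Integrable (fun p : G × G => g (p.swap.1 - p.swap.2) * f p.swap.2) (μ.prod μ) :=
    h1.swap
  have e : (fun p : G × G => g (p.1 - p.2) * (f p.1 + f p.2)) =
      fun p => g (p.swap.1 - p.swap.2) * f p.swap.2 + g (p.1 - p.2) * f p.2 := by
    funext p
    rw [Prod.fst_swap, Prod.snd_swap, ← neg_sub p.1 p.2, heven, mul_add]
  rw [e]
  refine ⟨h2.add h1, ?_⟩
  rw [integral_add h2 h1, integral_prod_swap (fun p : G × G => g (p.1 - p.2) * f p.2),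
    integral_comp_sub_mul hg hf]
  ring

end ConvolutionIntegrand

/-- the far-away contribution is controlled by the `L¹` norm of `(w - ψ_L)₊`:
`|∫∫_{|x-y|≥1} K(t,x,y)(ψ(x) - ψ(y))((w-ψ_L)₊(x) - (w-ψ_L)₊(y))| ≤ C ∫ (w-ψ_L)₊`. -/
theorem statement_10 (N : ℕ) (hN : 1 ≤ N) (s Λ : ℝ) (hs : s ∈ Set.Ioo (0 : ℝ) 2) (hΛ : 1 < Λ) :
    ∃ C > (0 : ℝ), ∀ K : ℝ → En N → En N → ℝ, CondD N s Λ K →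
      ∀ t L : ℝ, 0 ≤ L → ∀ w : En N → ℝ,
        Integrable (fun x => max (w x - (L + psiFn N s x)) 0) →
        |∫ p in {p : En N × En N | 1 ≤ ‖p.1 - p.2‖},
            K t p.1 p.2 * (psiFn N s p.1 - psiFn N s p.2) *
              (max (w p.1 - (L + psiFn N s p.1)) 0 - max (w p.2 - (L + psiFn N s p.2)) 0)| ≤
          C * ∫ x, max (w x - (L + psiFn N s x)) 0 := by
  obtain ⟨hs0, hs2⟩ := hs
  set a : ℝ := N + s / 2
  have ha : 0 ≤ a := by positivity
  set g : En N → ℝ := fun x => (1 + ‖x‖) ^ (-a)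
  have hg : Integrable g := integrable_one_add_norm (by simp [a]; linarith)
  have hg0 : 0 ≤ ∫ x, g x := integral_nonneg fun x => by positivity
  have hs' : 0 < 1 - s / 2 := by linarith
  set c : ℝ := (1 - s / 2) * Λ * 2 ^ a
  have hc : 0 ≤ c := by positivity
  refine ⟨c * (2 * ∫ x, g x) + 1, by positivity, fun K hK t L _ w hf => ?_⟩
  set f : En N → ℝ := fun x => max (w x - (L + psiFn N s x)) 0
  have hf0 : ∀ x, 0 ≤ f x := fun x => le_max_right _ _
  obtain ⟨hint, hval⟩ := integral_comp_sub_mul_add hg hf (fun x => by simp [g])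
  have hpt : ∀ p : En N × En N, 1 ≤ ‖p.1 - p.2‖ →
      ‖K t p.1 p.2 * (psiFn N s p.1 - psiFn N s p.2) * (f p.1 - f p.2)‖ ≤
        c * (g (p.1 - p.2) * (f p.1 + f p.2)) := by
    rintro ⟨x, y⟩ (hxy : 1 ≤ ‖x - y‖)
    have hr : 0 < ‖x - y‖ := by linarith
    have hne : x ≠ y := sub_ne_zero.1 (norm_pos_iff.1 hr)
    have hff : |f x - f y| ≤ f x + f y :=
      abs_le.2 ⟨by linarith [hf0 x], by linarith [hf0 y]⟩
    rw [Real.norm_eq_abs, abs_mul, abs_mul]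
    calc |K t x y| * |psiFn N s x - psiFn N s y| * |f x - f y|
        ≤ (1 - s / 2) * Λ * ‖x - y‖ ^ (-((N : ℝ) + s)) * ‖x - y‖ ^ (s / 2) * (f x + f y) := by
          gcongr
          · exact hK.abs_le hs2.le (by linarith) t hne
          · exact abs_psiFn_sub_le hs0.le hs2.le x y
      _ = (1 - s / 2) * Λ * ‖x - y‖ ^ (-a) * (f x + f y) := by
          rw [mul_assoc ((1 - s / 2) * Λ), ← Real.rpow_add hr]
          congr 3
          ring
      _ ≤ (1 - s / 2) * Λ * (2 ^ a * (1 + ‖x - y‖) ^ (-a)) * (f x + f y) := by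
          gcongr
          · exact rpow_neg_le_of_one_le hxy ha
      _ = c * (g (x - y) * (f x + f y)) := by ring
  have hS : MeasurableSet {p : En N × En N | 1 ≤ ‖p.1 - p.2‖} :=
    measurableSet_le measurable_const (by fun_prop)
  have hint' := hint.const_mul c
  have hnn : 0 ≤ ∫ x, f x := integral_nonneg hf0
  calc _ ≤ ∫ p in {p : En N × En N | 1 ≤ ‖p.1 - p.2‖},
          c * (g (p.1 - p.2) * (f p.1 + f p.2)) :=
        norm_integral_le_of_norm_le hint'.integrableOn (ae_restrict_of_forall_mem hS hpt)
    _ ≤ ∫ p : En N × En N, c * (g (p.1 - p.2) * (f p.1 + f p.2)) :=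
        setIntegral_le_integral hint' (ae_of_all _ fun p =>
          mul_nonneg hc (mul_nonneg (by positivity) (add_nonneg (hf0 _) (hf0 _))))
    _ = c * (2 * ∫ x, g x) * ∫ x, f x := by
        rw [integral_const_mul, Measure.volume_eq_prod, hval]
        ring
    _ ≤ (c * (2 * ∫ x, g x) + 1) * ∫ x, f x := by gcongr; linarith
end
end

section
/- Let N ≥ 1 and s ∈ (0,2) with s < N. There exists a constant C, depending only on N and s, such that for any T < 0 and any measurable v: [T,0] × ℝ^N → ℝ with M := sup_{t ∈ [T,0]} ∫_{ℝ^N} v(t,x)² dx + ∫_T^0 ∫_{ℝ^N} ∫_{ℝ^N} (v(t,x) − v(t,y))² |x−y|^{−(N+s)} dx dy dt < ∞, one has ‖v‖_{L^{2(1+s/N)}([T,0] × ℝ^N)} ≤ C M^{1/2}. -/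
open MeasureTheory Set Metric Filter
open scoped ENNReal NNReal Topology RealInnerProductSpace

noncomputable section

lemma volume_real_unitBall_pos (N : ℕ) : 0 < volume.real (ball (0 : En N) 1) :=
  ENNReal.toReal_pos (measure_ball_pos _ _ one_pos).ne' measure_ball_lt_top.ne

/-- Lower bound for the integral of `(f x - f y) ^ 2` over a ball whose radius is adapted
to `f x` and to the `L²` mass of `f`. -/
lemma le_lintegral_ball_sub_sq {N : ℕ} {f : En N → ℝ} (hf : Measurable f) {m : ℝ}
    (hm : 0 < m) (hfm : ∫⁻ y, ENNReal.ofReal (f y ^ 2) ≤ ENNReal.ofReal m)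
    (x : En N) {r : ℝ} (hr : 4 * m ≤ f x ^ 2 * volume.real (ball x r)) :
    ENNReal.ofReal m ≤ ∫⁻ y in ball x r, ENNReal.ofReal ((f x - f y) ^ 2) := by
  have hball : volume (ball x r) ≠ ⊤ := measure_ball_lt_top.ne
  have hpt : ∀ y, ENNReal.ofReal (f x ^ 2) ≤
      2 * ENNReal.ofReal ((f x - f y) ^ 2) + 2 * ENNReal.ofReal (f y ^ 2) := by
    intro y
    rw [← ENNReal.ofReal_ofNat 2, ← ENNReal.ofReal_mul (by norm_num),
      ← ENNReal.ofReal_mul (by norm_num), ← ENNReal.ofReal_add (by positivity) (by positivity)]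
    exact ENNReal.ofReal_le_ofReal (by nlinarith [sq_nonneg (f x - 2 * f y)])
  have hint : ENNReal.ofReal (4 * m) ≤
      2 * (∫⁻ y in ball x r, ENNReal.ofReal ((f x - f y) ^ 2)) + 2 * ENNReal.ofReal m := by
    calc ENNReal.ofReal (4 * m) ≤ ENNReal.ofReal (f x ^ 2 * volume.real (ball x r)) :=
          ENNReal.ofReal_le_ofReal hr
      _ = ∫⁻ _ in ball x r, ENNReal.ofReal (f x ^ 2) := by
          rw [setLIntegral_const, ENNReal.ofReal_mul (by positivity), ofReal_measureReal hball]
      _ ≤ ∫⁻ y in ball x r,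
            (2 * ENNReal.ofReal ((f x - f y) ^ 2) + 2 * ENNReal.ofReal (f y ^ 2)) :=
          lintegral_mono hpt
      _ = 2 * (∫⁻ y in ball x r, ENNReal.ofReal ((f x - f y) ^ 2)) +
            2 * ∫⁻ y in ball x r, ENNReal.ofReal (f y ^ 2) := by
          rw [lintegral_add_left (by fun_prop), lintegral_const_mul' _ _ (by simp),
            lintegral_const_mul' _ _ (by simp)]
      _ ≤ _ := by
          gcongr
          exact (setLIntegral_le_lintegral _ _).trans hfm
  generalize ∫⁻ y in ball x r, ENNReal.ofReal ((f x - f y) ^ 2) = J at hint ⊢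
  by_cases hJ : J = ⊤
  · simp [hJ]
  lift J to ℝ≥0 using hJ
  rw [← ENNReal.ofReal_coe_nnreal, ← ENNReal.ofReal_ofNat 2,
    ← ENNReal.ofReal_mul (by norm_num), ← ENNReal.ofReal_mul (by norm_num),
    ← ENNReal.ofReal_add (by positivity) (by positivity),
    ENNReal.ofReal_le_ofReal_iff (by positivity)] at hint
  rw [← ENNReal.ofReal_coe_nnreal]
  exact ENNReal.ofReal_le_ofReal (by linarith)

lemma lintegral_ball_sub_sq_le {N : ℕ} {s : ℝ} (hs : 0 < s) (f : En N → ℝ) (x : En N)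
    {r : ℝ} (hr : 0 < r) :
    ∫⁻ y in ball x r, ENNReal.ofReal ((f x - f y) ^ 2) ≤
      ENNReal.ofReal (r ^ ((N : ℝ) + s)) *
        ∫⁻ y, ENNReal.ofReal ((f x - f y) ^ 2 * ‖x - y‖ ^ (-((N : ℝ) + s))) := by
  rw [← lintegral_const_mul' _ _ ENNReal.ofReal_ne_top]
  refine (setLIntegral_mono' measurableSet_ball fun y hy => ?_).trans
    (setLIntegral_le_lintegral _ _)
  rw [← ENNReal.ofReal_mul (by positivity)]
  refine ENNReal.ofReal_le_ofReal ?_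
  rcases eq_or_ne x y with rfl | hxy
  · simp
  have hpos : 0 < ‖x - y‖ := norm_pos_iff.2 (sub_ne_zero.2 hxy)
  have hlt : ‖x - y‖ < r := by rwa [mem_ball, dist_comm, dist_eq_norm] at hy
  have hone : 1 ≤ r ^ ((N : ℝ) + s) * ‖x - y‖ ^ (-((N : ℝ) + s)) := by
    rw [Real.rpow_neg hpos.le, ← div_eq_mul_inv, one_le_div (by positivity)]
    exact Real.rpow_le_rpow hpos.le hlt.le (by positivity)
  nlinarith [mul_le_mul_of_nonneg_left hone (sq_nonneg (f x - f y))]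

/-- Pointwise form of the interpolation inequality between `L²` and the Gagliardo seminorm. -/
lemma ofReal_sq_rpow_le {N : ℕ} (hN : 1 ≤ N) {s : ℝ} (hs : 0 < s) {f : En N → ℝ}
    (hf : Measurable f) {m : ℝ} (hm : 0 < m)
    (hfm : ∫⁻ y, ENNReal.ofReal (f y ^ 2) ≤ ENNReal.ofReal m) (x : En N) :
    ENNReal.ofReal ((f x ^ 2) ^ (1 + s / N)) ≤
      ENNReal.ofReal ((4 / volume.real (ball (0 : En N) 1)) ^ (1 + s / N) * m ^ (s / N)) *
        ∫⁻ y, ENNReal.ofReal ((f x - f y) ^ 2 * ‖x - y‖ ^ (-((N : ℝ) + s))) := by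
  have hN0 : (0 : ℝ) < N := by exact_mod_cast hN
  have hp : 0 < 1 + s / N := by positivity
  set ω := volume.real (ball (0 : En N) 1)
  have hω0 : 0 < ω := volume_real_unitBall_pos N
  rcases eq_or_ne (f x) 0 with h0 | h0
  · simp [h0, Real.zero_rpow hp.ne']
  have ha : 0 < f x ^ 2 := by positivity
  set b := 4 * m / (ω * f x ^ 2) with hb
  have hb0 : 0 < b := by positivity
  have hr0 : 0 < b ^ (1 / (N : ℝ)) := by positivity
  have hvol : volume.real (ball x (b ^ (1 / (N : ℝ)))) = b * ω := by
    rw [Measure.real, Measure.addHaar_ball_of_pos _ _ hr0, ENNReal.toReal_mul,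
      ENNReal.toReal_ofReal (by positivity), finrank_euclideanSpace_fin, ← Real.rpow_natCast,
      ← Real.rpow_mul hb0.le, one_div_mul_cancel hN0.ne', Real.rpow_one]
    rfl
  have hlow := le_lintegral_ball_sub_sq hf hm hfm x (r := b ^ (1 / (N : ℝ))) (by
    rw [hvol, hb]
    exact le_of_eq (by field_simp))
  have key := hlow.trans (lintegral_ball_sub_sq_le hs f x hr0)
  rw [← Real.rpow_mul hb0.le, show 1 / (N : ℝ) * (N + s) = 1 + s / N by field_simp] at key
  have hcoef : (f x ^ 2) ^ (1 + s / N) / m * b ^ (1 + s / N) =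
      (4 / ω) ^ (1 + s / N) * m ^ (s / N) := by
    rw [show b = 4 / ω * m / f x ^ 2 by rw [hb]; field_simp,
      Real.div_rpow (by positivity) ha.le, Real.mul_rpow (by positivity) hm.le,
      Real.rpow_add hm, Real.rpow_one]
    have := Real.rpow_pos_of_pos ha (1 + s / N)
    field_simp
  calc ENNReal.ofReal ((f x ^ 2) ^ (1 + s / N))
      = ENNReal.ofReal ((f x ^ 2) ^ (1 + s / N) / m) * ENNReal.ofReal m := by
        rw [← ENNReal.ofReal_mul (by positivity), div_mul_cancel₀ _ hm.ne']
    _ ≤ ENNReal.ofReal ((f x ^ 2) ^ (1 + s / N) / m) * (ENNReal.ofReal (b ^ (1 + s / N)) *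
          ∫⁻ y, ENNReal.ofReal ((f x - f y) ^ 2 * ‖x - y‖ ^ (-((N : ℝ) + s)))) := by gcongr
    _ = _ := by rw [← mul_assoc, ← ENNReal.ofReal_mul (by positivity), hcoef]

lemma lintegral_sq_rpow_le_gagliardoSq {N : ℕ} (hN : 1 ≤ N) {s : ℝ} (hs : 0 < s)
    {f : En N → ℝ} (hf : Measurable f) {m : ℝ} (hm : 0 < m)
    (hfm : ∫⁻ y, ENNReal.ofReal (f y ^ 2) ≤ ENNReal.ofReal m) :
    ∫⁻ x, ENNReal.ofReal ((f x ^ 2) ^ (1 + s / N)) ≤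
      ENNReal.ofReal ((4 / volume.real (ball (0 : En N) 1)) ^ (1 + s / N) * m ^ (s / N)) *
        gagliardoSq N s f := by
  rw [gagliardoSq, ← lintegral_const_mul' _ _ ENNReal.ofReal_ne_top]
  exact lintegral_mono (ofReal_sq_rpow_le hN hs hf hm hfm)

/-- Space-time interpolation inequality in integral form. -/
lemma lintegral_lintegral_sq_rpow_le {N : ℕ} (hN : 1 ≤ N) {s : ℝ} (hs : 0 < s) {I : Set ℝ}
    (hI : MeasurableSet I) {v : ℝ → En N → ℝ} (hv : Measurable (Function.uncurry v))
    {M : ℝ≥0∞} (hM : M ≠ ⊤) (hsup : ∀ t ∈ I, ∫⁻ x, ENNReal.ofReal (v t x ^ 2) ≤ M)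
    (hgag : ∫⁻ t in I, gagliardoSq N s (v t) ≤ M) :
    ∫⁻ t in I, ∫⁻ x, ENNReal.ofReal ((v t x ^ 2) ^ (1 + s / N)) ≤
      (ENNReal.ofReal (4 / volume.real (ball (0 : En N) 1)) * M) ^ (1 + s / N) := by
  have hp : 0 < 1 + s / N := by positivity
  have hω0 : 0 < volume.real (ball (0 : En N) 1) := volume_real_unitBall_pos N
  have main : ∀ m : ℝ, 0 < m → M ≤ ENNReal.ofReal m →
      ∫⁻ t in I, ∫⁻ x, ENNReal.ofReal ((v t x ^ 2) ^ (1 + s / N)) ≤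
        ENNReal.ofReal ((4 / volume.real (ball (0 : En N) 1)) ^ (1 + s / N) * m ^ (s / N)) *
          M := by
    intro m hm hMm
    refine le_trans ?_ (mul_le_mul_right hgag _)
    rw [← lintegral_const_mul' _ _ ENNReal.ofReal_ne_top]
    exact setLIntegral_mono' hI fun t ht => lintegral_sq_rpow_le_gagliardoSq hN hs
      (hv.comp measurable_prodMk_left) hm ((hsup t ht).trans hMm)
  rcases eq_or_ne M 0 with rfl | hM0
  · exact (main 1 one_pos (by simp)).trans (by simp)
  have hm : 0 < M.toReal := ENNReal.toReal_pos hM0 hM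
  have hMm := ENNReal.ofReal_toReal hM
  refine (main M.toReal hm hMm.ge).trans_eq ?_
  generalize M.toReal = m at hm hMm
  rw [← hMm, ← ENNReal.ofReal_mul (by positivity), ← ENNReal.ofReal_mul (by positivity),
    ENNReal.ofReal_rpow_of_nonneg (by positivity) hp.le, Real.mul_rpow (by positivity) hm.le,
    Real.rpow_add hm, Real.rpow_one]
  congr 1
  ring

/-- space-time Sobolev interpolation: for `s < N`,
`‖v‖_{L^{2(1+s/N)}([T,0] × ℝ^N)} ≤ C (sup_t ∫ v² + ∫_T^0 ‖v(t)‖²_{H^{s/2}} dt)^{1/2}`. -/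
theorem statement_14 (N : ℕ) (hN : 1 ≤ N) (s : ℝ) (hs : s ∈ Set.Ioo (0 : ℝ) 2)
    (hsN : s < N) :
    ∃ C > (0 : ℝ), ∀ T : ℝ, T < 0 → ∀ v : ℝ → En N → ℝ,
      Measurable (Function.uncurry v) →
      eLpNorm (fun p : ℝ × En N => v p.1 p.2) (ENNReal.ofReal (2 * (1 + s / N)))
          (volume.restrict (Set.Icc T 0 ×ˢ Set.univ)) ≤
        ENNReal.ofReal C *
          ((⨆ t ∈ Set.Icc T 0, ∫⁻ x, ENNReal.ofReal ((v t x) ^ 2)) +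
            ∫⁻ t in Set.Icc T 0, gagliardoSq N s (v t)) ^ ((1 : ℝ) / 2) := by
  have hω0 : 0 < volume.real (ball (0 : En N) 1) := volume_real_unitBall_pos N
  have hp : 0 < 1 + s / N := by have := hs.1; positivity
  refine ⟨(4 / volume.real (ball (0 : En N) 1)) ^ ((1 : ℝ) / 2), by positivity,
    fun T _ v hv => ?_⟩
  set M : ℝ≥0∞ := (⨆ t ∈ Set.Icc T 0, ∫⁻ x, ENNReal.ofReal ((v t x) ^ 2)) +
    ∫⁻ t in Set.Icc T 0, gagliardoSq N s (v t)
  rcases eq_or_ne M ⊤ with hM | hM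
  · rw [hM, ENNReal.top_rpow_of_pos (by norm_num), ENNReal.mul_top]
    · exact le_top
    · exact (ENNReal.ofReal_pos.2 (by positivity)).ne'
  have key := lintegral_lintegral_sq_rpow_le hN hs.1 measurableSet_Icc hv hM
    (fun t ht => (le_iSup₂ (f := fun t (_ : t ∈ Set.Icc T 0) =>
      ∫⁻ x, ENNReal.ofReal ((v t x) ^ 2)) t ht).trans le_self_add) le_add_self
  have hpow : ∀ t x, ‖v t x‖ₑ ^ (2 * (1 + s / N)) =
      ENNReal.ofReal ((v t x ^ 2) ^ (1 + s / N)) := by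
    intro t x
    rw [Real.enorm_eq_ofReal_abs, ENNReal.ofReal_rpow_of_nonneg (abs_nonneg _) (by positivity),
      Real.rpow_mul (abs_nonneg _), Real.rpow_two, sq_abs]
  rw [eLpNorm_eq_lintegral_rpow_enorm_toReal (ENNReal.ofReal_pos.2 (by positivity)).ne'
    ENNReal.ofReal_ne_top, ENNReal.toReal_ofReal (by positivity), Measure.volume_eq_prod,
    ← Measure.prod_restrict, Measure.restrict_univ,
    lintegral_prod (fun p : ℝ × En N => ‖v p.1 p.2‖ₑ ^ (2 * (1 + s / (N : ℝ))))
      (hv.enorm.pow_const _).aemeasurable]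
  simp only [hpow]
  refine (ENNReal.rpow_le_rpow key (by positivity)).trans_eq ?_
  rw [← ENNReal.rpow_mul, show (1 + s / N) * (1 / (2 * (1 + s / N))) = (1 : ℝ) / 2 by
      generalize 1 + s / (N : ℝ) = p at hp; field_simp,
    ENNReal.mul_rpow_of_nonneg _ _ (by norm_num),
    ENNReal.ofReal_rpow_of_nonneg (by positivity) (by norm_num)]
end
end

section
/- Let N ≥ 1, s ∈ (0,2), Λ > 1. There exists a constant C, depending only on N, s, and Λ, such that for all λ ∈ (0,1/3): ∫_{B_3} ∫_{ℝ^N} ψ_λ(y)² (1−s/2) Λ |x−y|^{−(N+s)} dy dx ≤ C λ², where ψ_λ(y) = 0 if |y| ≤ λ^{−4/s} and ψ_λ(y) = ((|y| − λ^{−4/s})^{s/4} − 1)_+ if |y| ≥ λ^{−4/s}. -/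
open MeasureTheory Set Metric Filter
open scoped ENNReal NNReal Topology RealInnerProductSpace

noncomputable section

section PowerTail

variable {E : Type*} [NormedAddCommGroup E] [NormedSpace ℝ E] [FiniteDimensional ℝ E]
  [MeasurableSpace E] [BorelSpace E] (μ : Measure E) [μ.IsAddHaarMeasure]

/-- The power `‖z‖ ^ (-r)` is integrable away from the unit ball when `r` exceeds the dimension. -/
lemma lintegral_norm_rpow_neg_lt_top {r : ℝ} (hr : (Module.finrank ℝ E : ℝ) < r) :
    ∫⁻ z in {z : E | 1 < ‖z‖}, ENNReal.ofReal (‖z‖ ^ (-r)) ∂μ < ⊤ := by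
  have hr0 : 0 ≤ r := (Nat.cast_nonneg _).trans hr.le
  calc ∫⁻ z in {z : E | 1 < ‖z‖}, ENNReal.ofReal (‖z‖ ^ (-r)) ∂μ
      ≤ ∫⁻ z in {z : E | 1 < ‖z‖},
          ENNReal.ofReal (2 ^ r) * ENNReal.ofReal ((1 + ‖z‖) ^ (-r)) ∂μ := by
        refine setLIntegral_mono' (measurableSet_lt measurable_const measurable_norm)
          fun z hz => ?_
        have hz1 : 1 < ‖z‖ := hz
        rw [← ENNReal.ofReal_mul (by positivity)]
        refine ENNReal.ofReal_le_ofReal ?_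
        have h2 : (2 : ℝ) ^ r = (2⁻¹ : ℝ) ^ (-r) := by
          rw [Real.rpow_neg (by norm_num), Real.inv_rpow (by norm_num), inv_inv]
        rw [h2, ← Real.mul_rpow (by norm_num) (by positivity)]
        exact Real.rpow_le_rpow_of_nonpos (by positivity) (by linarith) (by linarith)
    _ ≤ ∫⁻ z, ENNReal.ofReal (2 ^ r) * ENNReal.ofReal ((1 + ‖z‖) ^ (-r)) ∂μ :=
        setLIntegral_le_lintegral _ _
    _ = ENNReal.ofReal (2 ^ r) * ∫⁻ z, ENNReal.ofReal ((1 + ‖z‖) ^ (-r)) ∂μ :=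
        lintegral_const_mul' _ _ ENNReal.ofReal_ne_top
    _ < ⊤ := ENNReal.mul_lt_top ENNReal.ofReal_lt_top (finite_integral_one_add_norm hr)

/-- Scaling of the tail integral of a power of the norm. -/
lemma lintegral_norm_rpow_neg_tail (q : ℝ) {R : ℝ} (hR : 0 < R) :
    ∫⁻ y in {y : E | R < ‖y‖}, ENNReal.ofReal (‖y‖ ^ (-((Module.finrank ℝ E : ℝ) + q))) ∂μ =
      ENNReal.ofReal (R ^ (-q)) *
        ∫⁻ z in {z : E | 1 < ‖z‖},
          ENNReal.ofReal (‖z‖ ^ (-((Module.finrank ℝ E : ℝ) + q))) ∂μ := by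
  set n := Module.finrank ℝ E with hn
  set p : ℝ := -((n : ℝ) + q) with hp
  have hS : ∀ a : ℝ, MeasurableSet {z : E | a < ‖z‖} := fun a =>
    measurableSet_lt measurable_const measurable_norm
  have hmeas : Measurable fun z : E => ENNReal.ofReal (‖z‖ ^ p) :=
    (measurable_norm.pow_const p).ennreal_ofReal
  have hmap := Measure.map_addHaar_smul μ (inv_ne_zero hR.ne')
  have key : ∫⁻ z, {z : E | 1 < ‖z‖}.indicator (fun z => ENNReal.ofReal (‖z‖ ^ p)) z
      ∂(Measure.map (R⁻¹ • ·) μ) = ENNReal.ofReal (R⁻¹ ^ p) *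
      ∫⁻ y in {y : E | R < ‖y‖}, ENNReal.ofReal (‖y‖ ^ p) ∂μ := by
    rw [lintegral_map (hmeas.indicator (hS 1)) (measurable_const_smul _),
      ← lintegral_const_mul' _ _ ENNReal.ofReal_ne_top, ← lintegral_indicator (hS R)]
    refine lintegral_congr fun y => ?_
    have hiff : 1 < ‖R⁻¹ • y‖ ↔ R < ‖y‖ := by
      rw [norm_smul, Real.norm_of_nonneg (by positivity), inv_mul_eq_div, one_lt_div hR]
    by_cases hy : R < ‖y‖
    · rw [indicator_of_mem (show R⁻¹ • y ∈ {z : E | 1 < ‖z‖} from hiff.2 hy),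
        indicator_of_mem (show y ∈ {y : E | R < ‖y‖} from hy),
        ← ENNReal.ofReal_mul (by positivity), norm_smul, Real.norm_of_nonneg (by positivity),
        Real.mul_rpow (by positivity) (by positivity)]
    · rw [indicator_of_notMem (show R⁻¹ • y ∉ {z : E | 1 < ‖z‖} from fun h => hy (hiff.1 h)),
        indicator_of_notMem (show y ∉ {y : E | R < ‖y‖} from hy)]
  rw [hmap, lintegral_smul_measure, lintegral_indicator (hS 1), smul_eq_mul] at key
  have hone : ENNReal.ofReal (R ^ p) * ENNReal.ofReal (R⁻¹ ^ p) = 1 := by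
    rw [← ENNReal.ofReal_mul (by positivity), ← Real.mul_rpow hR.le (by positivity),
      mul_inv_cancel₀ hR.ne', Real.one_rpow, ENNReal.ofReal_one]
  have hpow : R ^ p * |((R⁻¹) ^ n)⁻¹| = R ^ (-q) := by
    rw [abs_of_pos (by positivity), inv_pow, inv_inv, ← Real.rpow_natCast, ← Real.rpow_add hR]
    congr 1
    rw [hp]
    ring
  calc _ = ENNReal.ofReal (R ^ p) * (ENNReal.ofReal (R⁻¹ ^ p) *
      ∫⁻ y in {y : E | R < ‖y‖}, ENNReal.ofReal (‖y‖ ^ p) ∂μ) := by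
        rw [← mul_assoc, hone, one_mul]
    _ = _ := by
        rw [← key, ← mul_assoc, ← ENNReal.ofReal_mul (by positivity), hpow]

end PowerTail

lemma psiLam_sq_le (N : ℕ) {s lam : ℝ} (hs : 0 < s) (hlam : 0 < lam) (y : En N) :
    psiLam N s lam y ^ 2 ≤ ‖y‖ ^ (s / 2) := by
  unfold psiLam
  split_ifs with h
  · simpa using Real.rpow_nonneg (norm_nonneg y) (s / 2)
  · have hR : 0 < lam ^ (-(4 / s)) := Real.rpow_pos_of_pos hlam _
    have hle : max ((‖y‖ - lam ^ (-(4 / s))) ^ (s / 4) - 1) 0 ≤ ‖y‖ ^ (s / 4) := by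
      refine max_le ?_ (by positivity)
      have := Real.rpow_le_rpow (z := s / 4) (x := ‖y‖ - lam ^ (-(4 / s))) (y := ‖y‖)
        (by linarith) (by linarith) (by positivity)
      linarith
    calc _ ≤ (‖y‖ ^ (s / 4)) ^ 2 := pow_le_pow_left₀ (le_max_right _ _) hle 2
      _ = ‖y‖ ^ (s / 2) := by
        rw [← Real.rpow_mul_natCast (norm_nonneg y)]
        congr 1
        push_cast
        ring

/-- Pointwise bound of the tail integrand for `x` in the ball of radius `3`. -/
lemma psiLam_sq_mul_kernel_le (N : ℕ) {s Λ lam : ℝ} (hs : s ∈ Set.Ioo (0 : ℝ) 2) (hΛ : 0 < Λ)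
    (hlam : lam ∈ Set.Ioo (0 : ℝ) (1 / 3)) {x y : En N} (hx : ‖x‖ < 3)
    (hy : lam ^ (-(4 / s)) < ‖y‖) :
    psiLam N s lam y ^ 2 * (1 - s / 2) * Λ * ‖x - y‖ ^ (-((N : ℝ) + s)) ≤
      (1 - s / 2) * Λ * (2 / 3) ^ (-((N : ℝ) + s)) * ‖y‖ ^ (-((N : ℝ) + s / 2)) := by
  obtain ⟨hs0, hs2⟩ := hs
  obtain ⟨hl0, hl1⟩ := hlam
  have h9 : 9 ≤ lam ^ (-(4 / s)) := by
    calc (9 : ℝ) = (1 / 3 : ℝ) ^ (-2 : ℝ) := by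
          rw [Real.rpow_neg (by norm_num)]; norm_num
      _ ≤ lam ^ (-2 : ℝ) := Real.rpow_le_rpow_of_nonpos hl0 hl1.le (by norm_num)
      _ ≤ lam ^ (-(4 / s)) := by
          refine Real.rpow_le_rpow_of_exponent_ge hl0 (by linarith) (neg_le_neg ?_)
          rw [le_div_iff₀ hs0]
          linarith
  have hy0 : 0 < ‖y‖ := by linarith
  have hxy : 2 / 3 * ‖y‖ ≤ ‖x - y‖ := by
    have := norm_sub_norm_le y x
    rw [norm_sub_rev] at this
    linarith
  have hker : ‖x - y‖ ^ (-((N : ℝ) + s)) ≤ (2 / 3) ^ (-((N : ℝ) + s)) * ‖y‖ ^ (-((N : ℝ) + s)) := by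
    rw [← Real.mul_rpow (by norm_num) hy0.le]
    refine Real.rpow_le_rpow_of_nonpos (by positivity) hxy ?_
    have := Nat.cast_nonneg (α := ℝ) N
    linarith
  have hc : 0 ≤ 1 - s / 2 := by linarith
  calc _ = (1 - s / 2) * Λ * (psiLam N s lam y ^ 2 * ‖x - y‖ ^ (-((N : ℝ) + s))) := by ring
    _ ≤ (1 - s / 2) * Λ * (‖y‖ ^ (s / 2) *
          ((2 / 3) ^ (-((N : ℝ) + s)) * ‖y‖ ^ (-((N : ℝ) + s)))) := by
        gcongr
        exact psiLam_sq_le N hs0 hl0 y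
    _ = (1 - s / 2) * Λ * (2 / 3) ^ (-((N : ℝ) + s)) *
          (‖y‖ ^ (s / 2) * ‖y‖ ^ (-((N : ℝ) + s))) := by ring
    _ = _ := by
        rw [← Real.rpow_add hy0]
        congr 2
        ring

/-- tail estimate: for all `λ ∈ (0,1/3)`,
`∫_{B₃} ∫_{ℝ^N} ψ_λ(y)² (1-s/2) Λ |x-y|^{-(N+s)} dy dx ≤ C λ²`. -/
theorem statement_15 (N : ℕ) (hN : 1 ≤ N) (s Λ : ℝ) (hs : s ∈ Set.Ioo (0 : ℝ) 2)
    (hΛ : 1 < Λ) :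
    ∃ C > (0 : ℝ), ∀ lam ∈ Set.Ioo (0 : ℝ) (1 / 3),
      (∫⁻ x in ball (0 : En N) 3, ∫⁻ y, ENNReal.ofReal
          ((psiLam N s lam y) ^ 2 * (1 - s / 2) * Λ * ‖x - y‖ ^ (-((N : ℝ) + s)))) ≤
        ENNReal.ofReal (C * lam ^ 2) := by
  have hs0 := hs.1
  have hs2 := hs.2
  set J := ∫⁻ z in {z : En N | 1 < ‖z‖}, ENNReal.ofReal (‖z‖ ^ (-((N : ℝ) + s / 2))) with hJ
  have hJtop : J ≠ ⊤ :=
    (lintegral_norm_rpow_neg_lt_top (volume : Measure (En N)) (by simpa using hs0)).ne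
  set A : ℝ := (1 - s / 2) * Λ * (2 / 3) ^ (-((N : ℝ) + s)) with hA
  have hA0 : 0 ≤ A := mul_nonneg (mul_nonneg (by linarith) (by linarith)) (by positivity)
  set V := volume (ball (0 : En N) 3) with hV
  have hVtop : V ≠ ⊤ := measure_ball_lt_top.ne
  have hD : 0 ≤ A * J.toReal * V.toReal :=
    mul_nonneg (mul_nonneg hA0 ENNReal.toReal_nonneg) ENNReal.toReal_nonneg
  refine ⟨A * J.toReal * V.toReal + 1, by positivity, fun lam hlam => ?_⟩
  have hl0 := hlam.1
  set R := lam ^ (-(4 / s)) with hR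
  have hR0 : 0 < R := Real.rpow_pos_of_pos hl0 _
  have hRpow : R ^ (-(s / 2)) = lam ^ 2 := by
    rw [hR, ← Real.rpow_mul hl0.le, ← Real.rpow_natCast]
    congr 1
    push_cast
    field_simp
    norm_num
  have hinner : ∀ x ∈ ball (0 : En N) 3, ∫⁻ y, ENNReal.ofReal
      ((psiLam N s lam y) ^ 2 * (1 - s / 2) * Λ * ‖x - y‖ ^ (-((N : ℝ) + s))) ≤
        ENNReal.ofReal A * (ENNReal.ofReal (lam ^ 2) * J) := by
    intro x hx
    have hset : MeasurableSet {y : En N | R < ‖y‖} :=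
      measurableSet_lt measurable_const measurable_norm
    have htail := lintegral_norm_rpow_neg_tail (volume : Measure (En N)) (s / 2) hR0
    rw [finrank_euclideanSpace_fin, hRpow, ← hJ] at htail
    rw [← htail, ← lintegral_const_mul' _ _ ENNReal.ofReal_ne_top, ← lintegral_indicator hset]
    refine lintegral_mono fun y => ?_
    by_cases hy : R < ‖y‖
    · rw [indicator_of_mem (show y ∈ {y : En N | R < ‖y‖} from hy), ← ENNReal.ofReal_mul hA0]
      exact ENNReal.ofReal_le_ofReal (psiLam_sq_mul_kernel_le N hs (by linarith) hlam
        (by simpa using hx) hy)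
    · simp [psiLam, not_lt.1 hy, ← hR]
  calc _ ≤ ∫⁻ _ in ball (0 : En N) 3, ENNReal.ofReal A * (ENNReal.ofReal (lam ^ 2) * J) :=
        setLIntegral_mono' measurableSet_ball hinner
    _ = ENNReal.ofReal (A * (lam ^ 2 * J.toReal) * V.toReal) := by
        rw [setLIntegral_const, ENNReal.ofReal_mul (mul_nonneg hA0 (by positivity)),
          ENNReal.ofReal_mul hA0, ENNReal.ofReal_mul (sq_nonneg lam),
          ENNReal.ofReal_toReal hJtop, ENNReal.ofReal_toReal hVtop]
    _ ≤ _ := by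
        refine ENNReal.ofReal_le_ofReal ?_
        nlinarith [sq_nonneg lam]
end
end
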